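/- Suppose the positive integer sequences (m_k), (n_k) satisfy Keane's conditions and that \bar A_{m_1,n_1}\cdots\bar A_{m_k,n_k}(e_2) converges as k → ∞ to a vector u (so |u|_1 = 1). Then for every k ≥ 1 and every vector v ∈ ℝ⁴ with nonnegative entries satisfying B_k v = u, one has b_{k,2} · v_2 ≥ 1/3. -/

import Mathlib

open MeasureTheory Filter Set Matrix Topology

noncomputable section

/-- Keane's 4×4 matrix `A_{m,n}` with rows (0,0,1,1), (m−1,m,0,0), (n,n,n−1,n), (1,1,1,1). -/
def Amat (m n : ℕ) : Matrix (Fin 4) (Fin 4) ℝ :=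
  !![0, 0, 1, 1;
     (m : ℝ) - 1, (m : ℝ), 0, 0;
     (n : ℝ), (n : ℝ), (n : ℝ) - 1, (n : ℝ);
     1, 1, 1, 1]

/-- `B_k = A_{m_1,n_1} A_{m_2,n_2} ⋯ A_{m_k,n_k}` (sequences indexed from 1). -/
def Bmat (m n : ℕ → ℕ) (k : ℕ) : Matrix (Fin 4) (Fin 4) ℝ :=
  ((List.range k).map fun i => Amat (m (i + 1)) (n (i + 1))).prod

/-- `|v|₁`, the sum of the absolute values of the entries of `v`. -/
def l1norm (v : Fin 4 → ℝ) : ℝ := ∑ i, |v i|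

/-- `b_{k,i} = |B_k e_i|₁`; here columns are indexed from 0, so `e_i` is the
basis vector with a 1 in position `i` where `i : Fin 4` (e.g. the paper's `e_2` is `i = 1`). -/
def bnum (m n : ℕ → ℕ) (k : ℕ) (i : Fin 4) : ℝ := l1norm fun j => Bmat m n k j i

/-- `Ā_{m,n}(v) = A_{m,n} v / |A_{m,n} v|₁`. -/
def Abar (m n : ℕ) (v : Fin 4 → ℝ) : Fin 4 → ℝ :=
  (l1norm (Amat m n *ᵥ v))⁻¹ • (Amat m n *ᵥ v)

/-- `barSeq m n k v = Ā_{m_1,n_1} Ā_{m_2,n_2} ⋯ Ā_{m_k,n_k} (v)`. -/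
def barSeq (m n : ℕ → ℕ) : ℕ → (Fin 4 → ℝ) → Fin 4 → ℝ
  | 0, v => v
  | k + 1, v => barSeq m n k (Abar (m (k + 1)) (n (k + 1)) v)

/-- The paper's `e₂ = (0,1,0,0)ᵀ`. -/
def e2 : Fin 4 → ℝ := ![0, 1, 0, 0]

/-- The paper's `e₃ = (0,0,1,0)ᵀ`. -/
def e3 : Fin 4 → ℝ := ![0, 0, 1, 0]

/-- Keane's conditions: the sequences are positive integers, `3(n_k+1) ≤ m_k ≤ (n_{k+1}+1)/2`
for all `k ≥ 1`, and `n_1 ≥ 10`. -/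
def KeaneCond (m n : ℕ → ℕ) : Prop :=
  (∀ k, 1 ≤ k → 1 ≤ m k ∧ 1 ≤ n k) ∧
  (∀ k, 1 ≤ k → 3 * (n k + 1) ≤ m k ∧ 2 * m k ≤ n (k + 1) + 1) ∧
  10 ≤ n 1

/-- The permutation (4213) (one-indexed: π(1)=4, π(2)=2, π(3)=1, π(4)=3), written zero-indexed. -/
def kperm : Fin 4 → Fin 4 := ![3, 1, 0, 2]

/-- The 4-interval exchange transformation with length vector `l` and permutation (4213):
on `I_j = [l_1+⋯+l_{j−1}, l_1+⋯+l_j)` it is `x ↦ x − ∑_{k<j} l_k + ∑_{π(k')<π(j)} l_{k'}`. -/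
def iet (l : Fin 4 → ℝ) (x : ℝ) : ℝ :=
  if x < l 0 then
    x + ∑ k ∈ Finset.univ.filter (fun k => kperm k < kperm 0), l k
  else if x < l 0 + l 1 then
    x - l 0 + ∑ k ∈ Finset.univ.filter (fun k => kperm k < kperm 1), l k
  else if x < l 0 + l 1 + l 2 then
    x - (l 0 + l 1) + ∑ k ∈ Finset.univ.filter (fun k => kperm k < kperm 2), l k
  else
    x - (l 0 + l 1 + l 2) + ∑ k ∈ Finset.univ.filter (fun k => kperm k < kperm 3), l k

/-- The IET regarded as a self-map of `ℝ`, extended by the identity off `[0,1)`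
(a measure `μ` with `μ [0,1) = 1` then plays the role of a Borel measure on `[0,1)`). -/
def ietFull (l : Fin 4 → ℝ) (x : ℝ) : ℝ :=
  if x ∈ Set.Ico (0 : ℝ) 1 then iet l x else x

/-- Nonnegative vectors of total mass `1` whose entry of index `1` is at least `1 / 3`. -/
def heavySimplex : Set (Fin 4 → ℝ) :=
  {w | (∀ i, 0 ≤ w i) ∧ ∑ i, w i = 1 ∧ 1 ≤ 3 * w 1}

lemma e2_mem_heavySimplex : e2 ∈ heavySimplex := by
  refine ⟨fun i => ?_, ?_, ?_⟩
  · fin_cases i <;> simp [e2]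
  · simp [e2, Fin.sum_univ_four]
  · norm_num [e2]

lemma Amat_mulVec (m n : ℕ) (w : Fin 4 → ℝ) :
    Amat m n *ᵥ w = ![w 2 + w 3, (m - 1) * w 0 + m * w 1,
      n * w 0 + n * w 1 + (n - 1) * w 2 + n * w 3, w 0 + w 1 + w 2 + w 3] := by
  ext i
  fin_cases i <;> simp [Amat, Matrix.mulVec, dotProduct, Fin.sum_univ_four]

lemma Abar_mem_heavySimplex {m n : ℕ} (hn : 1 ≤ n) (hm : 3 * (n + 1) ≤ m)
    {w : Fin 4 → ℝ} (hw : w ∈ heavySimplex) : Abar m n w ∈ heavySimplex := by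
  obtain ⟨h0, hsum, h1⟩ := hw
  rw [Fin.sum_univ_four] at hsum
  have hn' : (1 : ℝ) ≤ n := by exact_mod_cast hn
  have hm' : 3 * ((n : ℝ) + 1) ≤ m := by exact_mod_cast hm
  have hx := h0 0
  have hy := h0 1
  have hz := h0 2
  have ht := h0 3
  have hnonneg : ∀ i, 0 ≤ (Amat m n *ᵥ w) i := by
    have hm1 : (0 : ℝ) ≤ m - 1 := by linarith
    have hn1 : (0 : ℝ) ≤ n - 1 := by linarith
    rw [Amat_mulVec]
    intro i
    fin_cases i <;> simp <;> positivity
  have hnorm : l1norm (Amat m n *ᵥ w) = ∑ i, (Amat m n *ᵥ w) i :=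
    Finset.sum_congr rfl fun i _ => abs_of_nonneg (hnonneg i)
  have hpos : 0 < l1norm (Amat m n *ᵥ w) := by
    rw [hnorm]
    refine Finset.sum_pos' (fun i _ => hnonneg i) ⟨3, Finset.mem_univ _, ?_⟩
    simp [Amat_mulVec, hsum]
  have hle : l1norm (Amat m n *ᵥ w) ≤ 3 * (Amat m n *ᵥ w) 1 := by
    rw [hnorm, Fin.sum_univ_four, Amat_mulVec]
    simp
    nlinarith [mul_nonneg (sub_nonneg.2 hn') hx, mul_nonneg (sub_nonneg.2 hm') hx,
      mul_nonneg (sub_nonneg.2 hm') hy,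
      mul_le_mul_of_nonneg_left h1 (by linarith : (0 : ℝ) ≤ n + 2)]
  refine ⟨fun i => mul_nonneg (inv_nonneg.2 hpos.le) (hnonneg i), ?_, ?_⟩
  · simp only [Abar, Pi.smul_apply, smul_eq_mul, ← Finset.mul_sum]
    rw [← hnorm, inv_mul_cancel₀ hpos.ne']
  · simp only [Abar, Pi.smul_apply, smul_eq_mul]
    rw [mul_left_comm, ← div_eq_inv_mul, one_le_div hpos]
    exact hle

lemma barSeq_mem_heavySimplex {m n : ℕ → ℕ} (hK : KeaneCond m n) (k : ℕ) :
    ∀ w ∈ heavySimplex, barSeq m n k w ∈ heavySimplex := by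
  induction k with
  | zero => exact fun w hw => hw
  | succ k ih =>
    exact fun w hw => ih _ (Abar_mem_heavySimplex (hK.1 (k + 1) (by simp)).2
      (hK.2.1 (k + 1) (by simp)).1 hw)

lemma exists_barSeq_add_eq {m n : ℕ → ℕ} (hK : KeaneCond m n) (k j : ℕ) :
    ∀ w ∈ heavySimplex, ∃ w' ∈ heavySimplex, barSeq m n (k + j) w = barSeq m n k w' := by
  induction j with
  | zero => exact fun w hw => ⟨w, hw, rfl⟩
  | succ j ih =>
    exact fun w hw => ih _ (Abar_mem_heavySimplex (hK.1 (k + j + 1) (by simp)).2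
      (hK.2.1 (k + j + 1) (by simp)).1 hw)

lemma Bmat_succ (m n : ℕ → ℕ) (k : ℕ) :
    Bmat m n (k + 1) = Bmat m n k * Amat (m (k + 1)) (n (k + 1)) := by
  simp [Bmat, List.range_succ]

lemma exists_barSeq_eq_Bmat_mulVec (m n : ℕ → ℕ) (k : ℕ) :
    ∀ w, ∃ c : ℝ, 0 ≤ c ∧ barSeq m n k w = Bmat m n k *ᵥ (c • w) := by
  induction k with
  | zero => exact fun w => ⟨1, zero_le_one, by simp [barSeq, Bmat]⟩
  | succ k ih =>
    intro w
    obtain ⟨c, hc, h⟩ := ih (Abar (m (k + 1)) (n (k + 1)) w)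
    refine ⟨c * (l1norm (Amat (m (k + 1)) (n (k + 1)) *ᵥ w))⁻¹,
      mul_nonneg hc (inv_nonneg.2 (Finset.sum_nonneg fun i _ => abs_nonneg _)), ?_⟩
    rw [barSeq, h, Bmat_succ, ← Matrix.mulVec_mulVec, Matrix.mulVec_smul (Amat _ _), mul_smul]
    rfl

lemma isUnit_det_Amat (m n : ℕ) : IsUnit (Amat m n).det := by
  have h : (Amat m n).det = 1 := by
    simp [Amat, Matrix.det_succ_row_zero, Fin.sum_univ_succ, Fin.succAbove]
    ring
  simp [h]

lemma isUnit_det_Bmat (m n : ℕ → ℕ) (k : ℕ) : IsUnit (Bmat m n k).det := by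
  induction k with
  | zero => simp [Bmat]
  | succ k ih =>
    rw [Bmat_succ, Matrix.det_mul]
    exact ih.mul (isUnit_det_Amat _ _)

/-- The column sums of `B_k` are nonnegative, and the one of index `1` is the largest. -/
lemma Bmat_colSum_le {m n : ℕ → ℕ} (hK : KeaneCond m n) (k : ℕ) :
    (∀ i, 0 ≤ ∑ j, Bmat m n k j i) ∧
      ∀ i, ∑ j, Bmat m n k j i ≤ ∑ j, Bmat m n k j 1 := by
  induction k with
  | zero => simp [Bmat, Matrix.one_apply]
  | succ k ih =>
    have hm : (1 : ℝ) ≤ m (k + 1) := by exact_mod_cast (hK.1 (k + 1) (by simp)).1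
    have hn : (1 : ℝ) ≤ n (k + 1) := by exact_mod_cast (hK.1 (k + 1) (by simp)).2
    have hstep : ∀ i, ∑ j, Bmat m n (k + 1) j i =
        ∑ l, (∑ j, Bmat m n k j l) * Amat (m (k + 1)) (n (k + 1)) l i := by
      intro i
      simp only [Bmat_succ, Matrix.mul_apply, Finset.sum_mul]
      exact Finset.sum_comm
    simp only [hstep]
    generalize (m (k + 1)) = a at *
    generalize (n (k + 1)) = b at *
    generalize hs : (fun i => ∑ j, Bmat m n k j i) = s at *
    have hs' : ∀ i, ∑ j, Bmat m n k j i = s i := fun i => congrFun hs i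
    simp only [hs'] at ih ⊢
    obtain ⟨h0, h1⟩ := ih
    have ha : (0 : ℝ) ≤ a - 1 := by linarith
    have hb : (0 : ℝ) ≤ b - 1 := by linarith
    have s0 := h0 0
    have s1 := h0 1
    have s2 := h0 2
    have s3 := h0 3
    have h10 := h1 0
    constructor <;> intro i <;> fin_cases i <;>
      simp [Amat, Fin.sum_univ_four] <;>
      first
        | positivity
        | nlinarith [mul_nonneg s1 ha, mul_nonneg s2 hb]

/-- Lemma 3: if `B_k v = u` with `v ≥ 0`, then `b_{k,2}·v₂ ≥ 1/3` (this quantity is the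
`λ₂`-measure of the orbit `O(I₂⁽ᵏ⁾)`). -/
theorem lemma_three (m n : ℕ → ℕ) (hK : KeaneCond m n)
    (u : Fin 4 → ℝ)
    (hconv : Tendsto (fun k => barSeq m n k e2) atTop (𝓝 u)) :
    ∀ k, 1 ≤ k → ∀ v : Fin 4 → ℝ, (∀ i, 0 ≤ v i) → Bmat m n k *ᵥ v = u →
      (1 : ℝ) / 3 ≤ bnum m n k 1 * v 1 := by
  intro k _ v hv hBv
  have hmass : ∑ i, v i ≤ 3 * v 1 := by
    have hinv : Tendsto (fun K => (Bmat m n k)⁻¹ *ᵥ barSeq m n K e2) atTop (𝓝 v) := by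
      have hv' : v = (Bmat m n k)⁻¹ *ᵥ u := by
        rw [← hBv, Matrix.mulVec_mulVec, Matrix.nonsing_inv_mul _ (isUnit_det_Bmat m n k),
          Matrix.one_mulVec]
      rw [hv']
      exact ((Continuous.matrix_mulVec continuous_const continuous_id).tendsto u).comp hconv
    have hclosed : IsClosed {w : Fin 4 → ℝ | ∑ i, w i ≤ 3 * w 1} :=
      isClosed_le (by fun_prop) (by fun_prop)
    refine hclosed.mem_of_tendsto hinv ?_
    filter_upwards [eventually_ge_atTop k] with K hkK
    obtain ⟨j, rfl⟩ := Nat.exists_eq_add_of_le hkK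
    obtain ⟨w, ⟨-, hsum, hw⟩, h⟩ := exists_barSeq_add_eq hK k j e2 e2_mem_heavySimplex
    obtain ⟨c, hc, h'⟩ := exists_barSeq_eq_Bmat_mulVec m n k w
    rw [h, h', Matrix.mulVec_mulVec, Matrix.nonsing_inv_mul _ (isUnit_det_Bmat m n k),
      Matrix.one_mulVec]
    simp only [Pi.smul_apply, smul_eq_mul, ← Finset.mul_sum, hsum]
    nlinarith
  have husum : ∑ i, u i = 1 := by
    have hclosed : IsClosed {w : Fin 4 → ℝ | ∑ i, w i = 1} :=
      isClosed_eq (by fun_prop) (by fun_prop)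
    exact hclosed.mem_of_tendsto hconv
      (Eventually.of_forall fun K => (barSeq_mem_heavySimplex hK K e2 e2_mem_heavySimplex).2.1)
  obtain ⟨hcol0, hcol⟩ := Bmat_colSum_le hK k
  have hexpand : ∑ i, u i = ∑ i, (∑ j, Bmat m n k j i) * v i := by
    simp only [← hBv, Matrix.mulVec, dotProduct, Finset.sum_mul]
    exact Finset.sum_comm
  have hbound : 1 ≤ (∑ j, Bmat m n k j 1) * (3 * v 1) := by
    calc 1 = ∑ i, (∑ j, Bmat m n k j i) * v i := by rw [← hexpand, husum]
      _ ≤ ∑ i, (∑ j, Bmat m n k j 1) * v i :=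
        Finset.sum_le_sum fun i _ => mul_le_mul_of_nonneg_right (hcol i) (hv i)
      _ = (∑ j, Bmat m n k j 1) * ∑ i, v i := (Finset.mul_sum _ _ _).symm
      _ ≤ _ := mul_le_mul_of_nonneg_left hmass (hcol0 1)
  have hbnum : ∑ j, Bmat m n k j 1 ≤ bnum m n k 1 :=
    Finset.sum_le_sum fun j _ => le_abs_self _
  linarith [mul_le_mul_of_nonneg_right hbnum (hv 1)]
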